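/- arXiv:2511.12847 — 6 statements merged into one kernel-verified Lean document; each statement's English description precedes it below -/
import Mathlib

section
/- The Metropolis–Hastings kernel is π-reversible: with π(A) = ∫_A p dμ, the kernel P(x,A) = ∫_A q(x,y) α(x,y) dμ(y) + 1_A(x) (1 − ∫ q(x,y) α(x,y) dμ(y)) satisfies ∫_A P(x,B) dπ(x) = ∫_B P(x,A) dπ(x) for all measurable A, B. -/
open MeasureTheory
open scoped ENNReal NNReal

/-- The Metropolis–Hastings acceptance probability:
`α(x,y) = min{1, p(y)q(y,x)/(p(x)q(x,y))}` when `p(x)q(x,y) > 0`, and `1` otherwise. -/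
noncomputable def mhAccept {Ω : Type*} (p : Ω → ℝ≥0) (q : Ω → Ω → ℝ≥0) (x y : Ω) : ℝ≥0 :=
  if 0 < p x * q x y then min 1 (p y * q y x / (p x * q x y)) else 1

/-- The Metropolis–Hastings kernel:
`P(x,A) = ∫_A q(x,y) α(x,y) dμ(y) + 1_A(x) (1 − ∫ q(x,y) α(x,y) dμ(y))`. -/
noncomputable def mhKernel {Ω : Type*} [MeasurableSpace Ω] (μ : Measure Ω)
    (p : Ω → ℝ≥0) (q : Ω → Ω → ℝ≥0) (x : Ω) (A : Set Ω) : ℝ≥0∞ :=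
  (∫⁻ y in A, ((q x y * mhAccept p q x y : ℝ≥0) : ℝ≥0∞) ∂μ)
    + A.indicator (fun _ => 1 - ∫⁻ y, ((q x y * mhAccept p q x y : ℝ≥0) : ℝ≥0∞) ∂μ) x

/-- Detailed balance in pointwise form; it also holds where `p x * q x y = 0`. -/
theorem mul_mul_mhAccept {Ω : Type*} (p : Ω → ℝ≥0) (q : Ω → Ω → ℝ≥0) (x y : Ω) :
    p x * (q x y * mhAccept p q x y) = min (p x * q x y) (p y * q y x) := by
  rw [← mul_assoc, mhAccept]
  split_ifs with h
  · rw [mul_min, mul_one, mul_div_cancel₀ _ h.ne']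
  · simp [nonpos_iff_eq_zero.mp (not_lt.mp h)]

theorem measurable_uncurry_mhAccept {Ω : Type*} [MeasurableSpace Ω] {p : Ω → ℝ≥0}
    (hp : Measurable p) {q : Ω → Ω → ℝ≥0} (hq : Measurable (Function.uncurry q)) :
    Measurable (Function.uncurry (mhAccept p q)) := by
  have hxy : Measurable fun z : Ω × Ω => p z.1 * q z.1 z.2 := (hp.comp measurable_fst).mul hq
  have hyx : Measurable fun z : Ω × Ω => p z.2 * q z.2 z.1 := hxy.comp measurable_swap
  exact Measurable.ite (measurableSet_lt measurable_const hxy)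
    (measurable_const.min (hyx.div hxy)) measurable_const

/-- The `π`-mass moved from `A` to `B` splits into an accepted and a rejected part. -/
theorem setLIntegral_mhKernel {Ω : Type*} [MeasurableSpace Ω] (μ : Measure Ω) [SigmaFinite μ]
    {p : Ω → ℝ≥0} (hp : Measurable p) {q : Ω → Ω → ℝ≥0} (hq : Measurable (Function.uncurry q))
    {A B : Set Ω} (hA : MeasurableSet A) (hB : MeasurableSet B) :
    ∫⁻ x in A, mhKernel μ p q x B ∂(μ.withDensity fun x => (p x : ℝ≥0∞))
      = (∫⁻ x in A, ∫⁻ y in B, ((min (p x * q x y) (p y * q y x) : ℝ≥0) : ℝ≥0∞) ∂μ ∂μ)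
        + ∫⁻ x in B ∩ A,
            p x * (1 - ∫⁻ y, ((q x y * mhAccept p q x y : ℝ≥0) : ℝ≥0∞) ∂μ) ∂μ := by
  have hqa : Measurable fun z : Ω × Ω => ((q z.1 z.2 * mhAccept p q z.1 z.2 : ℝ≥0) : ℝ≥0∞) :=
    (hq.mul (measurable_uncurry_mhAccept hp hq)).coe_nnreal_ennreal
  have hacc : Measurable fun x =>
      ∫⁻ y in B, ((q x y * mhAccept p q x y : ℝ≥0) : ℝ≥0∞) ∂μ := hqa.lintegral_prod_right'
  have hrej : Measurable fun x =>
      1 - ∫⁻ y, ((q x y * mhAccept p q x y : ℝ≥0) : ℝ≥0∞) ∂μ :=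
    measurable_const.sub hqa.lintegral_prod_right'
  have hprej : Measurable fun x =>
      p x * (1 - ∫⁻ y, ((q x y * mhAccept p q x y : ℝ≥0) : ℝ≥0∞) ∂μ) :=
    hp.coe_nnreal_ennreal.mul hrej
  have hker : Measurable fun x => mhKernel μ p q x B := hacc.add (hrej.indicator hB)
  rw [setLIntegral_withDensity_eq_setLIntegral_mul μ hp.coe_nnreal_ennreal hker hA,
    ← Measure.restrict_restrict hB, ← lintegral_indicator hB,
    ← lintegral_add_right _ (hprej.indicator hB)]
  refine lintegral_congr fun x => ?_
  have hbal : ∫⁻ y in B, ((min (p x * q x y) (p y * q y x) : ℝ≥0) : ℝ≥0∞) ∂μ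
      = p x * ∫⁻ y in B, ((q x y * mhAccept p q x y : ℝ≥0) : ℝ≥0∞) ∂μ := by
    rw [← lintegral_const_mul' _ _ ENNReal.coe_ne_top]
    refine lintegral_congr fun y => ?_
    rw [← ENNReal.coe_mul, mul_mul_mhAccept]
  rw [hbal, Pi.mul_apply, mhKernel, mul_add]
  by_cases hx : x ∈ B <;> simp [hx]

/-- The Metropolis–Hastings kernel is `π`-reversible: with
`π(A) = ∫_A p dμ`, it satisfies `∫_A P(x,B) dπ(x) = ∫_B P(x,A) dπ(x)` for all
measurable `A, B`. -/
theorem stmt6 {Ω : Type*} [MeasurableSpace Ω] (μ : Measure Ω) [SigmaFinite μ]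
    (p : Ω → ℝ≥0) (hp : Measurable p)
    (hpint : ∫⁻ x, (p x : ℝ≥0∞) ∂μ = 1)
    (q : Ω → Ω → ℝ≥0) (hq : Measurable (Function.uncurry q))
    (hqint : ∀ x, ∫⁻ y, (q x y : ℝ≥0∞) ∂μ = 1) :
    ∀ A B : Set Ω, MeasurableSet A → MeasurableSet B →
      ∫⁻ x in A, mhKernel μ p q x B ∂(μ.withDensity fun x => (p x : ℝ≥0∞))
        = ∫⁻ x in B, mhKernel μ p q x A ∂(μ.withDensity fun x => (p x : ℝ≥0∞)) := by
  intro A B hA hB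
  have hxy : Measurable fun z : Ω × Ω => p z.1 * q z.1 z.2 := (hp.comp measurable_fst).mul hq
  have hmin : Measurable fun z : Ω × Ω =>
      ((min (p z.1 * q z.1 z.2) (p z.2 * q z.2 z.1) : ℝ≥0) : ℝ≥0∞) :=
    (hxy.min (hxy.comp measurable_swap)).coe_nnreal_ennreal
  rw [setLIntegral_mhKernel μ hp hq hA hB, setLIntegral_mhKernel μ hp hq hB hA,
    Set.inter_comm B A, lintegral_lintegral_swap hmin.aemeasurable]
  simp only [min_comm]
end

section
/- Let P and T be self-adjoint continuous linear operators on a real Hilbert space H with operator norms ‖P‖ ≤ 1 and ‖T‖ ≤ 1, and let f ∈ H with ‖f‖ = 1. Set a = 1 − ⟪Pf, f⟫ and b = 1 − ⟪Tf, f⟫ (both nonnegative). Then ⟪((1/2)(P∘T + T∘P)) f, f⟫ = ⟪Tf, Pf⟫ and ⟪Tf, Pf⟫ ≤ 1 − a − b + 2√(ab). -/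
open scoped RealInnerProductSpace

theorem norm_sub_apply_sq_le {H : Type*} [NormedAddCommGroup H] [InnerProductSpace ℝ H]
    (A : H →L[ℝ] H) (hA : ‖A‖ ≤ 1) (f : H) (hf : ‖f‖ = 1) :
    ‖f - A f‖ ^ 2 ≤ 2 * (1 - ⟪A f, f⟫) := by
  have h : ‖A f‖ ≤ 1 := by simpa [hf] using A.le_of_opNorm_le hA f
  rw [norm_sub_sq_real, real_inner_comm, hf]
  nlinarith [norm_nonneg (A f)]

/-- Let `P` and `T` be self-adjoint continuous linear operators on a real
Hilbert space `H` with operator norms `‖P‖ ≤ 1` and `‖T‖ ≤ 1`, and let `f ∈ H` with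
`‖f‖ = 1`. Set `a = 1 − ⟪Pf, f⟫` and `b = 1 − ⟪Tf, f⟫` (both nonnegative). Then
`⟪((1/2)(P∘T + T∘P)) f, f⟫ = ⟪Tf, Pf⟫` and `⟪Tf, Pf⟫ ≤ 1 − a − b + 2√(ab)`. -/
theorem stmt9 {H : Type*} [NormedAddCommGroup H] [InnerProductSpace ℝ H] [CompleteSpace H]
    (P T : H →L[ℝ] H)
    (hPsa : ∀ u v : H, ⟪P u, v⟫ = ⟪u, P v⟫)
    (hTsa : ∀ u v : H, ⟪T u, v⟫ = ⟪u, T v⟫)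
    (hPnorm : ‖P‖ ≤ 1) (hTnorm : ‖T‖ ≤ 1)
    (f : H) (hf : ‖f‖ = 1)
    (a b : ℝ) (ha : a = 1 - ⟪P f, f⟫) (hb : b = 1 - ⟪T f, f⟫) :
    0 ≤ a ∧ 0 ≤ b ∧
    ⟪((1/2 : ℝ) • (P ∘L T + T ∘L P)) f, f⟫ = ⟪T f, P f⟫ ∧
    ⟪T f, P f⟫ ≤ 1 - a - b + 2 * Real.sqrt (a * b) := by
  have hP := norm_sub_apply_sq_le P hPnorm f hf
  have hT := norm_sub_apply_sq_le T hTnorm f hf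
  rw [← ha] at hP
  rw [← hb] at hT
  have ha0 : 0 ≤ a := by linarith [sq_nonneg ‖f - P f‖]
  have hb0 : 0 ≤ b := by linarith [sq_nonneg ‖f - T f‖]
  refine ⟨ha0, hb0, ?_, ?_⟩
  · simp only [smul_apply, add_apply,
      ContinuousLinearMap.comp_apply, real_inner_smul_left, inner_add_left]
    rw [hPsa, real_inner_comm f (T (P f)), ← hTsa]
    ring
  · have hexp : ⟪T f, P f⟫ = 1 - a - b + ⟪f - T f, f - P f⟫ := by
      rw [inner_sub_left, inner_sub_right, inner_sub_right, real_inner_self_eq_norm_sq, hf,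
        real_inner_comm (P f) f, ha, hb]
      ring
    have hmul : ‖f - T f‖ * ‖f - P f‖ ≤ 2 * √(a * b) := by
      refine abs_le_of_sq_le_sq' ?_ (by positivity) |>.2
      rw [mul_pow, mul_pow, Real.sq_sqrt (mul_nonneg ha0 hb0)]
      calc ‖f - T f‖ ^ 2 * ‖f - P f‖ ^ 2 ≤ (2 * b) * (2 * a) := by gcongr
        _ = 2 ^ 2 * (a * b) := by ring
    linarith [real_inner_le_norm (f - T f) (f - P f)]
end

section
/- Let P and T be self-adjoint continuous linear operators on a real Hilbert space H with operator norms ‖P‖ ≤ 1 and ‖T‖ ≤ 1, and let ε ∈ [0,1]. Then the spectral-gap comparison 1 − ‖(1−ε)P + εT‖ ≥ ε(1−ε) (1 − ‖(1/2)(P∘T + T∘P)‖) holds. -/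
open scoped RealInnerProductSpace

/-- Let `P` and `T` be self-adjoint continuous linear operators on a real
Hilbert space `H` with operator norms `‖P‖ ≤ 1` and `‖T‖ ≤ 1`, and let `ε ∈ [0,1]`. Then
the spectral-gap comparison
`1 − ‖(1−ε)P + εT‖ ≥ ε(1−ε) (1 − ‖(1/2)(P∘T + T∘P)‖)` holds. -/
theorem stmt10 {H : Type*} [NormedAddCommGroup H] [InnerProductSpace ℝ H] [CompleteSpace H]
    (P T : H →L[ℝ] H)
    (hPsa : ∀ u v : H, ⟪P u, v⟫ = ⟪u, P v⟫)
    (hTsa : ∀ u v : H, ⟪T u, v⟫ = ⟪u, T v⟫)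
    (hPnorm : ‖P‖ ≤ 1) (hTnorm : ‖T‖ ≤ 1)
    (ε : ℝ) (hε0 : 0 ≤ ε) (hε1 : ε ≤ 1) :
    1 - ‖(1 - ε) • P + ε • T‖ ≥ ε * (1 - ε) * (1 - ‖(1/2 : ℝ) • (P ∘L T + T ∘L P)‖) := by
  have hP : IsSelfAdjoint P := ContinuousLinearMap.isSelfAdjoint_iff_isSymmetric.mpr hPsa
  have hT : IsSelfAdjoint T := ContinuousLinearMap.isSelfAdjoint_iff_isSymmetric.mpr hTsa
  set S : H →L[ℝ] H := (1/2 : ℝ) • (P ∘L T + T ∘L P) with hS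
  set K : H →L[ℝ] H := (1 - ε) • P + ε • T with hK
  have hKsa : IsSelfAdjoint K :=
    ((IsSelfAdjoint.all (1 - ε)).smul hP).add ((IsSelfAdjoint.all ε).smul hT)
  have hε1' : 0 ≤ 1 - ε := sub_nonneg.mpr hε1
  have hKK : K * K =
      (1 - ε) ^ 2 • (P * P) + ε ^ 2 • (T * T) + (2 * ε * (1 - ε)) • S := by
    have hS' : S = (1/2 : ℝ) • (P * T + T * P) := hS
    rw [hS', hK]
    simp only [add_mul, mul_add, smul_mul_assoc, mul_smul_comm]
    module
  have hPP : ‖P * P‖ ≤ 1 :=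
    (norm_mul_le P P).trans (mul_le_one₀ hPnorm (norm_nonneg P) hPnorm)
  have hTT : ‖T * T‖ ≤ 1 :=
    (norm_mul_le T T).trans (mul_le_one₀ hTnorm (norm_nonneg T) hTnorm)
  have hsq : ‖K‖ ^ 2 ≤ (1 - ε) ^ 2 + ε ^ 2 + 2 * ε * (1 - ε) * ‖S‖ := by
    calc ‖K‖ ^ 2 = ‖K * K‖ := hKsa.norm_mul_self.symm
      _ ≤ (1 - ε) ^ 2 * ‖P * P‖ + ε ^ 2 * ‖T * T‖ + 2 * ε * (1 - ε) * ‖S‖ := by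
        rw [hKK]
        refine norm_add₃_le.trans_eq ?_
        have h : 0 ≤ 2 * ε * (1 - ε) := by positivity
        rw [norm_smul, norm_smul, norm_smul, Real.norm_of_nonneg (sq_nonneg (1 - ε)),
          Real.norm_of_nonneg (sq_nonneg ε), Real.norm_of_nonneg h]
      _ ≤ (1 - ε) ^ 2 + ε ^ 2 + 2 * ε * (1 - ε) * ‖S‖ := by
        gcongr
        · exact mul_le_of_le_one_right (by positivity) hPP
        · exact mul_le_of_le_one_right (by positivity) hTT
  nlinarith [sq_nonneg (1 - ‖K‖)]
end

section
/- Let Ω be a measurable space in which singletons are measurable, let K₁ and K₂ be Markov kernels on Ω, and let m ∈ (0,1]. Suppose that for every x ∈ Ω and every measurable set A with x ∉ A one has K₁(x,A) ≥ m K₂(x,A). Then for every bounded measurable function f : Ω → ℝ and every x ∈ Ω, ∫ (f(y) − f(x))² K₁(x,dy) ≥ m ∫ (f(y) − f(x))² K₂(x,dy); consequently the Dirichlet forms compare as ∬ (f(y) − f(x))² K₁(x,dy) π(dx) ≥ m ∬ (f(y) − f(x))² K₂(x,dy) π(dx) for any measure π on Ω. -/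
open MeasureTheory
open scoped ENNReal

/-- If `c • ν ≤ μ` on measurable sets avoiding `x`, then the lower integrals of any function
vanishing at `x` compare accordingly. -/
theorem mul_lintegral_le_of_apply_eq_zero {Ω : Type*} [MeasurableSpace Ω]
    [MeasurableSingletonClass Ω] {μ ν : Measure Ω} {c : ℝ≥0∞} {x : Ω}
    (h : ∀ A : Set Ω, MeasurableSet A → x ∉ A → c * ν A ≤ μ A)
    {g : Ω → ℝ≥0∞} (hg : g x = 0) :
    c * ∫⁻ y, g y ∂ν ≤ ∫⁻ y, g y ∂μ := by
  have hx : MeasurableSet ({x}ᶜ : Set Ω) := (measurableSet_singleton x).compl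
  have hind : ({x}ᶜ : Set Ω).indicator g = g := by
    rw [Set.indicator_eq_self]
    rintro y hy rfl
    exact hy hg
  have hres (ρ : Measure Ω) : ∫⁻ y, g y ∂ρ = ∫⁻ y, g y ∂(ρ.restrict {x}ᶜ) := by
    rw [← lintegral_indicator hx, hind]
  have hle : c • ν.restrict {x}ᶜ ≤ μ.restrict {x}ᶜ := by
    refine Measure.le_iff.2 fun A hA => ?_
    rw [Measure.smul_apply, smul_eq_mul, Measure.restrict_apply hA, Measure.restrict_apply hA]
    exact h _ (hA.inter hx) fun hxA => hxA.2 rfl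
  rw [hres ν, hres μ, ← smul_eq_mul, ← lintegral_smul_measure]
  exact lintegral_mono' hle le_rfl

/-- Let `Ω` be a measurable space in which singletons are measurable, let
`K₁` and `K₂` be Markov kernels on `Ω`, and let `m ∈ (0,1]`. Suppose that for every `x ∈ Ω`
and every measurable set `A` with `x ∉ A` one has `K₁(x,A) ≥ m K₂(x,A)`. Then for every
bounded measurable function `f : Ω → ℝ` and every `x ∈ Ω`,
`∫ (f(y) − f(x))² K₁(x,dy) ≥ m ∫ (f(y) − f(x))² K₂(x,dy)`; consequently the Dirichlet
forms compare as
`∬ (f(y) − f(x))² K₁(x,dy) π(dx) ≥ m ∬ (f(y) − f(x))² K₂(x,dy) π(dx)`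
for any measure `π` on `Ω`. -/
theorem stmt11 {Ω : Type*} [MeasurableSpace Ω] [MeasurableSingletonClass Ω]
    (K₁ K₂ : Ω → Measure Ω) (hK₁m : Measurable K₁) (hK₂m : Measurable K₂)
    (hK₁ : ∀ x, IsProbabilityMeasure (K₁ x)) (hK₂ : ∀ x, IsProbabilityMeasure (K₂ x))
    (m : ℝ≥0∞) (hm0 : 0 < m) (hm1 : m ≤ 1)
    (hdom : ∀ x, ∀ A : Set Ω, MeasurableSet A → x ∉ A → m * K₂ x A ≤ K₁ x A) :
    ∀ f : Ω → ℝ, Measurable f → (∃ C, ∀ x, |f x| ≤ C) →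
      (∀ x, m * ∫⁻ y, ENNReal.ofReal ((f y - f x) ^ 2) ∂(K₂ x)
          ≤ ∫⁻ y, ENNReal.ofReal ((f y - f x) ^ 2) ∂(K₁ x)) ∧
      (∀ π : Measure Ω,
        m * ∫⁻ x, (∫⁻ y, ENNReal.ofReal ((f y - f x) ^ 2) ∂(K₂ x)) ∂π
          ≤ ∫⁻ x, (∫⁻ y, ENNReal.ofReal ((f y - f x) ^ 2) ∂(K₁ x)) ∂π) := by
  intro f _ _
  have hpt (x : Ω) : m * ∫⁻ y, ENNReal.ofReal ((f y - f x) ^ 2) ∂(K₂ x)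
      ≤ ∫⁻ y, ENNReal.ofReal ((f y - f x) ^ 2) ∂(K₁ x) :=
    mul_lintegral_le_of_apply_eq_zero (hdom x) (by simp)
  refine ⟨hpt, fun π => ?_⟩
  rw [← lintegral_const_mul' _ _ (ne_top_of_le_ne_top ENNReal.one_ne_top hm1)]
  exact lintegral_mono hpt
end

section
/- Let Ω be a metric space with its Borel σ-algebra, π a finite measure on Ω, and P a Markov kernel with P(x, closedBall(x, δ)) = 1 for every x. Let A ⊆ Ω be measurable with π(A) > 0, let μ ∈ A, set d = infDist(μ, Aᶜ), and assume 0 < δ < d. Suppose the mode-wise exponential concentration bound π(A ∩ {x : d(x, μ) ≥ r}) ≤ c e^{−ν r} π(A) holds for all r ∈ (0, d], where c ≥ 1 and ν > 0. Then the conductance-type bound ∫_A P(x, Aᶜ) dπ(x) ≤ c e^{−ν(d−δ)} π(A) holds. -/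
open MeasureTheory

/-- Let `Ω` be a metric space with its Borel σ-algebra, `π` a finite
measure on `Ω`, and `P` a Markov kernel with `P(x, closedBall(x, δ)) = 1` for every `x`.
Let `A ⊆ Ω` be measurable with `π(A) > 0`, let `μ₀ ∈ A`, set `d = infDist(μ₀, Aᶜ)`, and
assume `0 < δ < d`. Suppose the mode-wise exponential concentration bound
`π(A ∩ {x : d(x, μ₀) ≥ r}) ≤ c e^{−ν r} π(A)` holds for all `r ∈ (0, d]`, where `c ≥ 1`
and `ν > 0`. Then the conductance-type bound
`∫_A P(x, Aᶜ) dπ(x) ≤ c e^{−ν(d−δ)} π(A)` holds. -/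
theorem stmt13 {Ω : Type*} [MetricSpace Ω] [MeasurableSpace Ω] [BorelSpace Ω]
    (π : Measure Ω) [IsFiniteMeasure π] (δ : ℝ)
    (P : Ω → Measure Ω) (hPm : Measurable P) (hP : ∀ x, IsProbabilityMeasure (P x))
    (hloc : ∀ x, P x (Metric.closedBall x δ) = 1)
    (A : Set Ω) (hA : MeasurableSet A) (hApos : 0 < π A)
    (μ₀ : Ω) (hμ₀ : μ₀ ∈ A)
    (d : ℝ) (hd : d = Metric.infDist μ₀ Aᶜ)
    (hδ0 : 0 < δ) (hδd : δ < d)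
    (c ν : ℝ) (hc : 1 ≤ c) (hν : 0 < ν)
    (hconc : ∀ r : ℝ, 0 < r → r ≤ d →
      π (A ∩ {x | r ≤ dist x μ₀}) ≤ ENNReal.ofReal (c * Real.exp (-ν * r)) * π A) :
    ∫⁻ x in A, P x Aᶜ ∂π ≤ ENNReal.ofReal (c * Real.exp (-ν * (d - δ))) * π A := by
  have hfar : MeasurableSet {x | d - δ ≤ dist x μ₀} :=
    measurableSet_le measurable_const (continuous_id.dist continuous_const).measurable
  have hbound : ∀ x, P x Aᶜ ≤ {x | d - δ ≤ dist x μ₀}.indicator 1 x := by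
    intro x
    have := hP x
    by_cases hx : d - δ ≤ dist x μ₀
    · rw [Set.indicator_of_mem (by exact hx)]
      exact prob_le_one
    · have hsub : Aᶜ ⊆ (Metric.closedBall x δ)ᶜ := by
        intro y hy hyx
        have h₁ : d ≤ dist μ₀ y := hd ▸ Metric.infDist_le_dist_of_mem hy
        have h₂ : dist y x ≤ δ := hyx
        have h₃ := dist_triangle y x μ₀
        rw [dist_comm μ₀ y] at h₁
        linarith
      have hzero : P x (Metric.closedBall x δ)ᶜ = 0 :=
        (prob_compl_eq_zero_iff Metric.isClosed_closedBall.measurableSet).2 (hloc x)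
      exact (measure_mono hsub).trans (hzero.le.trans zero_le)
  calc ∫⁻ x in A, P x Aᶜ ∂π
      ≤ ∫⁻ x in A, {x | d - δ ≤ dist x μ₀}.indicator 1 x ∂π := lintegral_mono hbound
    _ = π (A ∩ {x | d - δ ≤ dist x μ₀}) := by
      rw [lintegral_indicator_one hfar, Measure.restrict_apply hfar, Set.inter_comm]
    _ ≤ ENNReal.ofReal (c * Real.exp (-ν * (d - δ))) * π A :=
      hconc _ (by linarith) (by linarith)
end

section
/- Uniform ergodicity from an n-step Doeblin minorization: let K be a Markov kernel on a measurable space Ω, n ≥ 1, ν a probability measure, and ε ∈ (0,1] such that the n-step kernel satisfies Kⁿ(x, A) ≥ ε ν(A) for every x and every measurable A. If π is a K-invariant probability measure (∫ K(x,A) dπ(x) = π(A) for all measurable A), then for every probability measure μ, every k ≥ 1, and every measurable A, |(μ K^{nk})(A) − π(A)| ≤ (1 − ε)^k. -/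
open MeasureTheory
open scoped ENNReal

/-- `kIter K n` is the `n`-fold composition of the kernel `K` with itself
(`kIter K 0` is the identity kernel), so that
`K^{n+1}(x,A) = ∫ Kⁿ(y,A) K(x,dy)`. -/
noncomputable def kIter {Ω : Type*} [MeasurableSpace Ω] (K : Ω → Measure Ω) :
    ℕ → Ω → Measure Ω
  | 0 => fun x => Measure.dirac x
  | n + 1 => fun x => (K x).bind (kIter K n)

open ProbabilityTheory

theorem kIter_eq_pow {Ω : Type*} [MeasurableSpace Ω] (κ : Kernel Ω Ω) (n : ℕ) :
    kIter κ n = ⇑(κ ^ n) := by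
  induction n with
  | zero => rfl
  | succ n ih =>
    funext x
    rw [pow_succ]
    change (κ x).bind (kIter κ n) = (κ x).bind ⇑(κ ^ n)
    rw [ih]

theorem ProbabilityTheory.Kernel.isMarkovKernel_pow {Ω : Type*} [MeasurableSpace Ω]
    (κ : Kernel Ω Ω) [IsMarkovKernel κ] (n : ℕ) : IsMarkovKernel (κ ^ n) := by
  induction n with
  | zero => exact inferInstanceAs (IsMarkovKernel Kernel.id)
  | succ n ih => rw [pow_succ]; exact inferInstanceAs (IsMarkovKernel ((κ ^ n) ∘ₖ κ))

theorem ProbabilityTheory.Kernel.Invariant.pow {Ω : Type*} [MeasurableSpace Ω]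
    {κ : Kernel Ω Ω} {π : Measure Ω} (h : Kernel.Invariant κ π) (n : ℕ) :
    Kernel.Invariant (κ ^ n) π := by
  induction n with
  | zero => exact Measure.bind_dirac
  | succ n ih => rw [pow_succ]; exact ih.comp h

/-- Under a Doeblin minorization by `a • ν`, with `a + b = 1`, the function `x ↦ κᵏ(x, A)`
oscillates by at most `bᵏ`. -/
theorem exists_forall_pow_apply_mem_Icc_of_minorization {Ω : Type*} [MeasurableSpace Ω]
    (κ : Kernel Ω Ω) [IsMarkovKernel κ] (ν : Measure Ω) [IsProbabilityMeasure ν] {a b : ℝ≥0∞}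
    (hab : a + b = 1) (h : ∀ x, a • ν ≤ κ x) (k : ℕ) {A : Set Ω} (hA : MeasurableSet A) :
    ∃ c : ℝ≥0∞, ∀ x, (κ ^ k) x A ∈ Set.Icc c (c + b ^ k) := by
  have ha : a ≠ ∞ := fun h => by simp [h] at hab
  have : IsFiniteMeasure (a • ν) := Measure.smul_finite ν ha
  induction k with
  | zero =>
    have := Kernel.isMarkovKernel_pow κ 0
    exact ⟨0, fun x => ⟨zero_le, by rw [pow_zero b, zero_add]; exact prob_le_one⟩⟩
  | succ k ih =>
    obtain ⟨c, hc⟩ := ih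
    refine ⟨a * ∫⁻ y, (κ ^ k) y A ∂ν + c * b, fun x => ?_⟩
    set ρ := κ x - a • ν
    have hρ : ρ + a • ν = κ x := Measure.sub_add_cancel_of_le (h x)
    have hρ1 : ρ Set.univ = b := by
      have h1 : ρ Set.univ + a = 1 := by
        have := congrArg (fun m : Measure Ω => m Set.univ) hρ
        simpa using this
      rw [← hab, add_comm] at h1
      exact (ENNReal.add_right_inj ha).1 h1
    have hstep : (κ ^ (k + 1)) x A
        = a * ∫⁻ y, (κ ^ k) y A ∂ν + ∫⁻ y, (κ ^ k) y A ∂ρ := by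
      rw [add_comm k, Kernel.pow_add_apply_eq_lintegral κ 1 k x hA, pow_one, ← hρ,
        lintegral_add_measure, lintegral_smul_measure, add_comm, smul_eq_mul]
    rw [hstep, add_assoc]
    constructor
    · gcongr
      calc c * b = ∫⁻ _, c ∂ρ := by rw [lintegral_const, hρ1]
        _ ≤ _ := lintegral_mono fun y => (hc y).1
    · gcongr
      calc ∫⁻ y, (κ ^ k) y A ∂ρ ≤ ∫⁻ _, c + b ^ k ∂ρ := lintegral_mono fun y => (hc y).2
        _ = _ := by rw [lintegral_const, hρ1, add_mul, pow_succ]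

theorem lintegral_mem_Icc_of_forall_mem_Icc {Ω : Type*} [MeasurableSpace Ω] {f : Ω → ℝ≥0∞}
    {c d : ℝ≥0∞} (hf : ∀ x, f x ∈ Set.Icc c d) (μ : Measure Ω) [IsProbabilityMeasure μ] :
    ∫⁻ x, f x ∂μ ∈ Set.Icc c d := by
  constructor
  · simpa using lintegral_mono (μ := μ) fun x => (hf x).1
  · simpa using lintegral_mono (μ := μ) fun x => (hf x).2

/-- Uniform ergodicity from an `n`-step Doeblin minorization: let `K` be a
Markov kernel on a measurable space `Ω`, `n ≥ 1`, `ν` a probability measure, and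
`ε ∈ (0,1]` such that the `n`-step kernel satisfies `Kⁿ(x, A) ≥ ε ν(A)` for every `x` and
every measurable `A`. If `π` is a `K`-invariant probability measure, then for every
probability measure `μ`, every `k ≥ 1`, and every measurable `A`,
`|(μ K^{nk})(A) − π(A)| ≤ (1 − ε)^k`. -/
theorem stmt18 {Ω : Type*} [MeasurableSpace Ω]
    (K : Ω → Measure Ω) (hKm : Measurable K) (hK : ∀ x, IsProbabilityMeasure (K x))
    (n : ℕ) (hn : 1 ≤ n)
    (ν : Measure Ω) [IsProbabilityMeasure ν]
    (ε : ℝ) (hε0 : 0 < ε) (hε1 : ε ≤ 1)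
    (hmin : ∀ x : Ω, ∀ A : Set Ω, MeasurableSet A →
      ENNReal.ofReal ε * ν A ≤ kIter K n x A)
    (π : Measure Ω) [IsProbabilityMeasure π]
    (hinv : ∀ A : Set Ω, MeasurableSet A → ∫⁻ x, K x A ∂π = π A) :
    ∀ μ : Measure Ω, IsProbabilityMeasure μ → ∀ k : ℕ, 1 ≤ k →
      ∀ A : Set Ω, MeasurableSet A →
        |(∫⁻ x, kIter K (n * k) x A ∂μ).toReal - (π A).toReal| ≤ (1 - ε) ^ k := by
  intro μ _ k _ A hA
  let κ : Kernel Ω Ω := ⟨K, hKm⟩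
  have : IsMarkovKernel κ := ⟨hK⟩
  have := Kernel.isMarkovKernel_pow κ n
  have hπ : Kernel.Invariant κ π :=
    Measure.ext fun s hs => by
      rw [Measure.bind_apply hs κ.measurable.aemeasurable]
      exact hinv s hs
  have hiter : ∀ m, kIter K m = ⇑(κ ^ m) := kIter_eq_pow κ
  have hab : ENNReal.ofReal ε + ENNReal.ofReal (1 - ε) = 1 := by
    rw [← ENNReal.ofReal_add hε0.le (sub_nonneg.2 hε1)]
    simp
  obtain ⟨c, hc⟩ := exists_forall_pow_apply_mem_Icc_of_minorization (κ ^ n) ν hab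
    (fun x => Measure.le_iff.2 fun s hs => by
      simpa [hiter] using hmin x s hs) k hA
  rw [← pow_mul] at hc
  have hμA := lintegral_mem_Icc_of_forall_mem_Icc hc μ
  have hπA := lintegral_mem_Icc_of_forall_mem_Icc hc π
  rw [← Measure.bind_apply hA (κ ^ (n * k)).measurable.aemeasurable, (hπ.pow (n * k)).def] at hπA
  rw [hiter]
  have hctop : c ≠ ∞ := ne_top_of_le_ne_top (measure_ne_top π A) hπA.1
  have hreal : ∀ t ∈ Set.Icc c (c + ENNReal.ofReal (1 - ε) ^ k),
      t.toReal ∈ Set.Icc c.toReal (c.toReal + (1 - ε) ^ k) := by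
    rintro t ⟨h1, h2⟩
    have hb : ENNReal.ofReal (1 - ε) ^ k ≠ ∞ := ENNReal.pow_ne_top ENNReal.ofReal_ne_top
    have htop : c + ENNReal.ofReal (1 - ε) ^ k ≠ ∞ := ENNReal.add_ne_top.2 ⟨hctop, hb⟩
    refine ⟨ENNReal.toReal_mono (ne_top_of_le_ne_top htop h2) h1, ?_⟩
    have := ENNReal.toReal_mono htop h2
    rwa [ENNReal.toReal_add hctop hb, ENNReal.toReal_pow,
      ENNReal.toReal_ofReal (sub_nonneg.2 hε1)] at this
  have h1 := hreal _ hμA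
  have h2 := hreal _ hπA
  exact abs_sub_le_iff.2 ⟨by linarith [h1.2, h2.1], by linarith [h2.2, h1.1]⟩
end
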